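/- arXiv:2010.04034 — 2 statements merged into one kernel-verified Lean document; each statement's English description precedes it below -/
import Mathlib

section
/- Let $1\le d<n$ be integers and let $C\ge 1$. Let $h:(0,\infty)\to\mathbb{R}$ be continuous with $C^{-1}\le h(s)\le C$ for all $s>0$, and define $u:\mathbb{R}^d\times\mathbb{R}^{n-d}\to\mathbb{R}$ by $u(x,t)=\int_0^{|t|} h(s)^{-1}\,ds$. Let $\mathcal{A}:\Omega\to\mathbb{R}^{n\times n}$ be measurable and bounded, with block decomposition $\mathcal{A}=\begin{pmatrix}\mathcal{A}_1&\mathcal{A}_2\\ \mathcal{A}_3&\mathcal{A}_4\end{pmatrix}$, and assume that for every $(x,t)\in\Omega$: the vector $\mathcal{A}_3(x,t)^T\,\tfrac{t}{|t|}\in\mathbb{R}^d$ does not depend on $x$, and $\mathcal{A}_4(x,t)^T\,\tfrac{t}{|t|}=h(|t|)\,\tfrac{t}{|t|}$. Then: (i) $u$ is $C^1$ on $\Omega$, continuous on the closure of $\Omega$, $u(x,t)=0$ exactly when $t=0$, and $C^{-1}|t|\le u(x,t)\le C|t|$ for all $(x,t)$; (ii) $u$ is a weak solution of $L^*u=-\mathop{\mathrm{div}}(|t|^{d+1-n}\mathcal{A}^T\nabla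 u)=0$ in $\Omega$, i.e. $\int_\Omega |t|^{d+1-n}\,\mathcal{A}(X)^T\nabla u(X)\cdot\nabla\varphi(X)\,dX=0$ for every Lipschitz function $\varphi:\Omega\to\mathbb{R}$ with compact support in $\Omega$. -/
open MeasureTheory Metric Set
open scoped ENNReal NNReal

noncomputable section

/-- Points of the ambient space `ℝ^d × ℝ^m` (where `m = n - d`). -/
abbrev Pt (d m : ℕ) := EuclideanSpace ℝ (Fin d) × EuclideanSpace ℝ (Fin m)

/-- The vertical parameter set `T ⊆ ℝ^m`: it is `(0,∞)` when `m = 1`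
(the codimension-one case `d = n-1`), and `ℝ^m \ {0}` otherwise. -/
def TSet (m : ℕ) : Set (EuclideanSpace ℝ (Fin m)) :=
  {t | t ≠ 0 ∧ (m = 1 → ∀ i, 0 < t i)}

/-- The domain `Ω`: `ℝ^{d+1}_+` when `m = 1`, and `ℝ^n \ ℝ^d` when `m ≥ 2`. -/
def Omega (d m : ℕ) : Set (Pt d m) := {P | P.2 ∈ TSet m}

/-- Partial derivative of `u` in the `j`-th horizontal direction. -/
def pdx {d m : ℕ} (u : Pt d m → ℝ) (P : Pt d m) (j : Fin d) : ℝ :=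
  fderiv ℝ u P ((EuclideanSpace.single j 1 : EuclideanSpace ℝ (Fin d)),
    (0 : EuclideanSpace ℝ (Fin m)))

/-- Partial derivative of `u` in the `i`-th vertical direction. -/
def pdt {d m : ℕ} (u : Pt d m → ℝ) (P : Pt d m) (i : Fin m) : ℝ :=
  fderiv ℝ u P ((0 : EuclideanSpace ℝ (Fin d)),
    (EuclideanSpace.single i 1 : EuclideanSpace ℝ (Fin m)))

/-- The full gradient of `u`, indexed by `Fin d ⊕ Fin m`. -/
def grad {d m : ℕ} (u : Pt d m → ℝ) (P : Pt d m) : Fin d ⊕ Fin m → ℝ :=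
  Sum.elim (pdx u P) (pdt u P)

/-- `|∇u|²`. -/
def gradSq {d m : ℕ} (u : Pt d m → ℝ) (P : Pt d m) : ℝ :=
  ∑ i : Fin d ⊕ Fin m, (grad u P i) ^ 2

/-- The Euclidean distance on `ℝ^d × ℝ^m = ℝ^n`. -/
def edist2 {d m : ℕ} (P Q : Pt d m) : ℝ :=
  Real.sqrt (‖P.1 - Q.1‖ ^ 2 + ‖P.2 - Q.2‖ ^ 2)

/-- `u` is a weak solution of `- div (|t|^{d+1-n} M ∇u) = 0` in `U`, tested against
Lipschitz functions compactly supported in `U`.  (Note `d + 1 - n = 1 - m`.) -/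
def IsWeakSolOn (d m : ℕ) (M : Pt d m → Matrix (Fin d ⊕ Fin m) (Fin d ⊕ Fin m) ℝ)
    (u : Pt d m → ℝ) (U : Set (Pt d m)) : Prop :=
  ∀ φ : Pt d m → ℝ, (∃ L : ℝ≥0, LipschitzWith L φ) → HasCompactSupport φ →
    tsupport φ ⊆ U →
    ∫ P in U, ‖P.2‖ ^ ((1 : ℝ) - (m : ℝ)) *
      (∑ i, (∑ j, M P i j * grad u P j) * grad φ P i) = 0

/-- The ellipticity and boundedness conditions, with constant `CL`:
`M ξ · ξ ≥ CL⁻¹ |ξ|²` and `|M ξ · ζ| ≤ CL |ξ| |ζ|` on `Ω`. -/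
def EllipticBounded (d m : ℕ) (M : Pt d m → Matrix (Fin d ⊕ Fin m) (Fin d ⊕ Fin m) ℝ)
    (CL : ℝ) : Prop :=
  ∀ P ∈ Omega d m, ∀ ξ ζ : Fin d ⊕ Fin m → ℝ,
    CL⁻¹ * (∑ i, (ξ i) ^ 2) ≤ (∑ i, (∑ j, M P i j * ξ j) * ξ i) ∧
    |∑ i, (∑ j, M P i j * ξ j) * ζ i| ≤
      CL * Real.sqrt (∑ i, (ξ i) ^ 2) * Real.sqrt (∑ i, (ζ i) ^ 2)

/-- The nontangential maximal function `N(v)(x)`, valued in `ℝ≥0∞`. -/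
def NtangE (d m : ℕ) (v : Pt d m → ℝ) (x : EuclideanSpace ℝ (Fin d)) : ℝ≥0∞ :=
  ⨆ P : {P : Pt d m // P ∈ Omega d m ∧ ‖P.1 - x‖ < ‖P.2‖}, ENNReal.ofReal |v P.val|

/-- The wide-aperture nontangential maximal function `N₁₀(v)(x)`. -/
def N10E (d m : ℕ) (v : Pt d m → ℝ) (x : EuclideanSpace ℝ (Fin d)) : ℝ≥0∞ :=
  ⨆ P : {P : Pt d m // P ∈ Omega d m ∧ ‖P.1 - x‖ < 10 * ‖P.2‖}, ENNReal.ofReal |v P.val|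

/-- Whitney ball `B((y,t), |t|/4)` (Euclidean ball of `ℝ^n`). -/
def whitneyBall {d m : ℕ} (P : Pt d m) : Set (Pt d m) := {Z | edist2 Z P < ‖P.2‖ / 4}

/-- The `L²` average `( ⨍_{B(P,|t|/4)} v² )^{1/2}`. -/
def whitneyAvg (d m : ℕ) (v : Pt d m → ℝ) (P : Pt d m) : ℝ :=
  Real.sqrt ((∫ Z in whitneyBall P, (v Z) ^ 2) / (volume (whitneyBall P)).toReal)

/-- The averaged nontangential maximal function `Ñ(v)(x)`, real-valued. -/
def Ntilde (d m : ℕ) (v : Pt d m → ℝ) (x : EuclideanSpace ℝ (Fin d)) : ℝ :=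
  ⨆ P : {P : Pt d m // P ∈ Omega d m ∧ ‖P.1 - x‖ < ‖P.2‖}, whitneyAvg d m v P.val

/-- The averaged nontangential maximal function `Ñ(v)(x)`, valued in `ℝ≥0∞`. -/
def NtildeE (d m : ℕ) (v : Pt d m → ℝ) (x : EuclideanSpace ℝ (Fin d)) : ℝ≥0∞ :=
  ⨆ P : {P : Pt d m // P ∈ Omega d m ∧ ‖P.1 - x‖ < ‖P.2‖},
    ENNReal.ofReal (whitneyAvg d m v P.val)

/-- The Carleson box `B(x,r) × {0 < |t| < r}`. -/
def carlesonBox (d m : ℕ) (x : EuclideanSpace ℝ (Fin d)) (r : ℝ) : Set (Pt d m) :=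
  (ball x r) ×ˢ {t : EuclideanSpace ℝ (Fin m) | 0 < ‖t‖ ∧ ‖t‖ < r}

/-- The Carleson measure condition `f ∈ CM₂(K)`. -/
def CM2 (d m : ℕ) (f : Pt d m → ℝ) (K : ℝ) : Prop :=
  (∀ P ∈ Omega d m, |f P| ≤ K) ∧
  ∀ (x : EuclideanSpace ℝ (Fin d)) (r : ℝ), 0 < r →
    (∫⁻ P in carlesonBox d m x r,
      ENNReal.ofReal ((f P) ^ 2) / ENNReal.ofReal (‖P.2‖ ^ m))
      ≤ ENNReal.ofReal K * volume (ball x r)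

/-- The Carleson measure condition `f ∈ C̃M₂(K)` with Whitney sup. -/
def CMtilde2 (d m : ℕ) (f : Pt d m → ℝ) (K : ℝ) : Prop :=
  ∀ (x : EuclideanSpace ℝ (Fin d)) (r : ℝ), 0 < r →
    (∫⁻ P in carlesonBox d m x r,
      (⨆ Z : {Z : Pt d m // Z ∈ Omega d m ∧ edist2 Z P < ‖P.2‖ / 4},
        ENNReal.ofReal ((f Z.val) ^ 2)) / ENNReal.ofReal (‖P.2‖ ^ m))
      ≤ ENNReal.ofReal K * volume (ball x r)

/-- The fixed cut-off profile `φ`. -/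
def cutoffProps (φ : ℝ → ℝ) : Prop :=
  ContDiff ℝ (⊤ : ℕ∞) φ ∧ (∀ s, 0 ≤ φ s ∧ φ s ≤ 1) ∧ (∀ s ∈ Ioo (-1 : ℝ) 1, φ s = 1) ∧
    (∀ s, 2 ≤ s → φ s = 0) ∧ ∀ s, |deriv φ s| ≤ 2

/-- The cut-off `Ψ_B` adapted to the tent over the ball `B = B(xB, r) ⊆ ℝ^d`. -/
def PsiB (d m : ℕ) (φ : ℝ → ℝ) (xB : EuclideanSpace ℝ (Fin d)) (r : ℝ) (P : Pt d m) : ℝ :=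
  φ (infDist P.1 (ball xB r) / ‖P.2‖) * φ (‖P.2‖ / r)

/-- The refined cut-off `Ψ_{B,ε}`. -/
def PsiBe (d m : ℕ) (φ : ℝ → ℝ) (xB : EuclideanSpace ℝ (Fin d)) (r ε : ℝ) (P : Pt d m) : ℝ :=
  PsiB d m φ xB r P * φ (ε / ‖P.2‖)

/-- `div_x (Mᵀ) ∈ ℝ^{n-d}`: the `k`-th entry is `∑_j ∂_{x_j} M_{k j}`. -/
def divX {d m : ℕ} (B : Pt d m → Matrix (Fin m) (Fin d) ℝ) (P : Pt d m) (k : Fin m) : ℝ :=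
  ∑ j, pdx (fun Q => B Q k j) P j

/-- `div_t M ∈ ℝ^d`: the `k`-th entry is `∑_i ∂_{t_i} M_{i k}`. -/
def divT {d m : ℕ} (B : Pt d m → Matrix (Fin m) (Fin d) ℝ) (P : Pt d m) (k : Fin d) : ℝ :=
  ∑ i, pdt (fun Q => B Q i k) P i

/-- Frobenius norm of a matrix, used for `|C₃|`, `|C₄|`. -/
def frobNorm {a b : ℕ} (M : Matrix (Fin a) (Fin b) ℝ) : ℝ :=
  Real.sqrt (∑ i, ∑ j, (M i j) ^ 2)

theorem integral_mul_fderiv_eq_zero_of_invariant {E : Type*} [NormedAddCommGroup E]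
    [NormedSpace ℝ E] [FiniteDimensional ℝ E] [MeasurableSpace E] [BorelSpace E]
    (μ : Measure E) [μ.IsAddHaarMeasure] {φ w : E → ℝ} {V : E → E} {K : Set E} {L : ℝ≥0} {ε : ℝ}
    (hφ : LipschitzWith L φ) (hw : Measurable w) (hV : Continuous V) (hK : IsCompact K)
    (hwK : IntegrableOn w K μ) (hε : 0 < ε)
    (hsupp : ∀ s : ℝ, |s| < ε → ∀ P ∉ K, φ (P + s • V P) = 0)
    (hinv : ∀ s : ℝ, |s| < ε → ∫ P, w P * φ (P + s • V P) ∂μ = ∫ P, w P * φ P ∂μ) :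
    Integrable (fun P => w P * fderiv ℝ φ P (V P)) μ ∧
      ∫ P, w P * fderiv ℝ φ P (V P) ∂μ = 0 := by
  obtain ⟨B, hB⟩ := hK.exists_bound_of_continuousOn hV.continuousOn
  obtain ⟨D, hD⟩ := hK.exists_bound_of_continuousOn hφ.continuous.continuousOn
  have hKm : MeasurableSet K := hK.measurableSet
  have hball : ball (0 : ℝ) ε ∈ nhds 0 := ball_mem_nhds 0 hε
  have hφ0 : ∀ P ∉ K, φ P = 0 := fun P hP => by
    simpa using hsupp 0 (by simpa using hε) P hP
  have key := hasDerivAt_integral_of_dominated_loc_of_lip (𝕜 := ℝ) (μ := μ)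
    (F := fun s P => w P * φ (P + s • V P)) (F' := fun P => w P * fderiv ℝ φ P (V P))
    (x₀ := 0) (s := ball 0 ε) (bound := K.indicator fun P => w P * (L * B)) hball
    (Filter.Eventually.of_forall fun s => by
      have : Continuous fun P => φ (P + s • V P) := hφ.continuous.comp (by fun_prop)
      exact (hw.mul this.measurable).aestronglyMeasurable)
    (by
      have h1 : IntegrableOn (fun P => w P * φ P) K μ :=
        hwK.mul_bdd (c := D) hφ.continuous.aestronglyMeasurable
          ((ae_restrict_iff' hKm).2 (Filter.Eventually.of_forall hD))
      have h2 := (integrable_indicator_iff hKm).2 h1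
      refine h2.congr (Filter.Eventually.of_forall fun P => ?_)
      by_cases hP : P ∈ K <;> simp [hP, hφ0])
    (by
      refine (hw.mul ?_).aestronglyMeasurable
      have : Measurable fun P => (fderiv ℝ φ P, V P) :=
        (measurable_fderiv ℝ φ).prodMk hV.measurable
      exact (isBoundedBilinearMap_apply (𝕜 := ℝ) (E := E) (F := ℝ)).continuous.measurable.comp this)
    (Filter.Eventually.of_forall fun P => by
      refine LipschitzOnWith.of_dist_le_mul fun s hs s' hs' => ?_
      rw [mem_ball_zero_iff, Real.norm_eq_abs] at hs hs'
      by_cases hP : P ∈ K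
      · have hL := hφ.dist_le_mul (P + s • V P) (P + s' • V P)
        rw [dist_add_left, dist_eq_norm (s • V P), ← sub_smul, norm_smul] at hL
        have hB0 : 0 ≤ B := (norm_nonneg _).trans (hB P hP)
        simp only [indicator_of_mem hP, Real.coe_nnabs, Real.dist_eq, ← mul_sub, abs_mul,
          abs_of_nonneg hB0, NNReal.abs_eq]
        rw [Real.dist_eq, Real.norm_eq_abs] at hL
        calc |w P| * |φ (P + s • V P) - φ (P + s' • V P)|
            ≤ |w P| * (L * (|s - s'| * B)) := by
              gcongr
              refine hL.trans ?_
              gcongr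
              exact hB P hP
          _ = _ := by ring
      · simp [hsupp s hs P hP, hsupp s' hs' P hP, hP])
    ((integrable_indicator_iff hKm).2 (hwK.mul_const _))
    (by
      filter_upwards [hφ.ae_differentiableAt (μ := μ)] with P hP
      have h1 : HasDerivAt (fun s : ℝ => P + s • V P) (V P) 0 := by
        simpa using ((hasDerivAt_id (0 : ℝ)).smul_const (V P)).const_add P
      have h2 : HasFDerivAt φ (fderiv ℝ φ P) (P + (0 : ℝ) • V P) := by
        simpa using hP.hasFDerivAt
      exact (h2.comp_hasDerivAt (0 : ℝ) h1).const_mul (w P))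
  refine ⟨key.1, key.2.unique ?_⟩
  refine (hasDerivAt_const (0 : ℝ) (∫ P, w P * φ P ∂μ)).congr_of_eventuallyEq ?_
  filter_upwards [hball] with s hs
  exact hinv s (by simpa using hs)

theorem isOpen_Omega (d m : ℕ) : IsOpen (Omega d m) := by
  have h1 : IsOpen {t : EuclideanSpace ℝ (Fin m) | m = 1 → ∀ i, 0 < t i} := by
    by_cases hm : m = 1
    · have : {t : EuclideanSpace ℝ (Fin m) | m = 1 → ∀ i, 0 < t i} =
          ⋂ i, {t : EuclideanSpace ℝ (Fin m) | 0 < t i} := by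
        ext t; simp [hm]
      rw [this]
      exact isOpen_iInter_of_finite fun i => isOpen_lt continuous_const (by fun_prop)
    · simp [hm]
  exact (isOpen_ne.inter h1).preimage continuous_snd

theorem smul_mem_TSet {m : ℕ} {c : ℝ} (hc : 0 < c) {t : EuclideanSpace ℝ (Fin m)}
    (ht : t ∈ TSet m) : c • t ∈ TSet m :=
  ⟨smul_ne_zero hc.ne' ht.1, fun hm i => by simpa using mul_pos hc (ht.2 hm i)⟩

theorem integral_mul_fderiv_horizontal_eq_zero {d m : ℕ} {φ w : Pt d m → ℝ} {L : ℝ≥0}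
    (hφ : LipschitzWith L φ) (hc : HasCompactSupport φ) (hsub : tsupport φ ⊆ Omega d m)
    (hw : Measurable w) (hwK : ∀ K ⊆ Omega d m, IsCompact K → IntegrableOn w K)
    (hwinv : ∀ (P : Pt d m) (y : EuclideanSpace ℝ (Fin d)), w (P + (y, 0)) = w P)
    (y : EuclideanSpace ℝ (Fin d)) :
    Integrable (fun P => w P * fderiv ℝ φ P (y, 0)) ∧
      ∫ P, w P * fderiv ℝ φ P (y, 0) = 0 := by
  have : (volume : Measure (Pt d m)).IsAddHaarMeasure := Measure.prod.instIsAddHaarMeasure _ _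
  set K : Set (Pt d m) :=
    (fun q : Pt d m × ℝ => q.1 - q.2 • ((y, 0) : Pt d m)) '' (tsupport φ ×ˢ Icc (-1) 1)
  have hK : IsCompact K := (IsCompact.prod hc isCompact_Icc).image (by fun_prop)
  have hKO : K ⊆ Omega d m := by
    rintro _ ⟨⟨P, s⟩, ⟨hP, -⟩, rfl⟩
    simpa [Omega] using hsub hP
  refine integral_mul_fderiv_eq_zero_of_invariant volume hφ hw (V := fun _ => (y, 0))
    continuous_const hK (hwK K hKO hK) one_pos (fun s hs P hP => ?_) (fun s _ => ?_)
  · refine image_eq_zero_of_notMem_tsupport fun hmem => hP ?_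
    exact ⟨(P + s • (y, 0), s), ⟨hmem, abs_le.1 hs.le⟩, by simp⟩
  · rw [← integral_add_right_eq_self (fun P => w P * φ P) (s • ((y, 0) : Pt d m))]
    refine integral_congr_ae (Filter.Eventually.of_forall fun P => ?_)
    have := hwinv P (s • y)
    simp only [Prod.smul_mk, smul_zero] at this ⊢
    rw [this]

theorem integral_inv_norm_pow_mul_comp_smul {m : ℕ} {c : ℝ} (hc : 0 < c)
    (ψ : EuclideanSpace ℝ (Fin m) → ℝ) :
    ∫ t, (‖t‖ ^ m)⁻¹ * ψ (c • t) = ∫ t, (‖t‖ ^ m)⁻¹ * ψ t := by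
  have hscale := Measure.integral_comp_smul (volume : Measure (EuclideanSpace ℝ (Fin m)))
    (fun t => (‖t‖ ^ m)⁻¹ * ψ t) c
  have hpm : 0 < c ^ m := pow_pos hc m
  simp only [norm_smul, Real.norm_eq_abs, abs_of_pos hc, mul_pow, mul_inv, mul_assoc,
    integral_const_mul, finrank_euclideanSpace, Fintype.card_fin, smul_eq_mul,
    abs_of_pos (inv_pos.2 hpm)] at hscale
  exact mul_left_cancel₀ (inv_ne_zero hpm.ne') hscale

theorem integral_fderiv_radial_eq_zero {d m : ℕ} {φ : Pt d m → ℝ} {L : ℝ≥0}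
    (hφ : LipschitzWith L φ) (hc : HasCompactSupport φ) (hsub : tsupport φ ⊆ Omega d m) :
    Integrable (fun P => (‖P.2‖ ^ m)⁻¹ * fderiv ℝ φ P (0, P.2)) ∧
      ∫ P, (‖P.2‖ ^ m)⁻¹ * fderiv ℝ φ P (0, P.2) = 0 := by
  have : (volume : Measure (Pt d m)).IsAddHaarMeasure := Measure.prod.instIsAddHaarMeasure _ _
  have hinvcont : ContinuousOn (fun q : Pt d m × ℝ => ((q.1.1, (1 + q.2)⁻¹ • q.1.2) : Pt d m))
      (tsupport φ ×ˢ Icc (-(1 / 2)) (1 / 2)) := by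
    have hne : ∀ q ∈ tsupport φ ×ˢ Icc (-(1 / 2)) (1 / 2), 1 + q.2 ≠ (0 : ℝ) := by
      rintro ⟨P, s⟩ ⟨-, hs⟩
      have := hs.1
      simp only at this ⊢
      linarith
    have hinv : ContinuousOn (fun q : Pt d m × ℝ => (1 + q.2)⁻¹)
        (tsupport φ ×ˢ Icc (-(1 / 2)) (1 / 2)) :=
      ContinuousOn.inv₀ (by fun_prop) hne
    exact ContinuousOn.prodMk (by fun_prop) (hinv.smul (by fun_prop))
  set K : Set (Pt d m) := (fun q : Pt d m × ℝ => ((q.1.1, (1 + q.2)⁻¹ • q.1.2) : Pt d m)) ''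
    (tsupport φ ×ˢ Icc (-(1 / 2)) (1 / 2))
  have hK : IsCompact K := (IsCompact.prod hc isCompact_Icc).image_of_continuousOn hinvcont
  have hKO : K ⊆ Omega d m := by
    rintro _ ⟨⟨P, s⟩, ⟨hP, hs⟩, rfl⟩
    have := hs.1
    exact smul_mem_TSet (inv_pos.2 (by simp only at this; linarith)) (hsub hP)
  have hweight : ContinuousOn (fun P : Pt d m => (‖P.2‖ ^ m)⁻¹) (Omega d m) :=
    ContinuousOn.inv₀ (by fun_prop) fun P hP => pow_ne_zero _ (norm_ne_zero_iff.2 hP.1)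
  have hsuppK : ∀ s : ℝ, |s| < 1 / 2 → ∀ P ∉ K, φ (P + s • (0, P.2)) = 0 := by
    intro s hs P hP
    refine image_eq_zero_of_notMem_tsupport fun hmem => hP ?_
    refine ⟨(P + s • (0, P.2), s), ⟨hmem, abs_le.1 hs.le⟩, ?_⟩
    have hs0 : 1 + s ≠ 0 := by
      have := (abs_lt.1 hs).1
      linarith
    ext1
    · simp
    · have : P.2 + s • P.2 = (1 + s) • P.2 := by rw [add_smul, one_smul]
      simp [this, smul_smul, hs0]
  have hint : ∀ s : ℝ, |s| < 1 / 2 →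
      Integrable fun P : Pt d m => (‖P.2‖ ^ m)⁻¹ * φ (P + s • (0, P.2)) := by
    intro s hs
    have hcont : Continuous fun P : Pt d m => φ (P + s • (0, P.2)) :=
      hφ.continuous.comp (by fun_prop)
    have h2 := (integrable_indicator_iff hK.measurableSet).2
      (((hweight.mono hKO).mul hcont.continuousOn).integrableOn_compact (μ := volume) hK)
    refine h2.congr (Filter.Eventually.of_forall fun P => ?_)
    by_cases hP : P ∈ K
    · simp [hP]
    · simp only [indicator_of_notMem hP, hsuppK s hs P hP, mul_zero]
  refine integral_mul_fderiv_eq_zero_of_invariant volume hφ (V := fun P => (0, P.2))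
    (w := fun P => (‖P.2‖ ^ m)⁻¹) (by fun_prop) (by fun_prop) hK
    ((hweight.mono hKO).integrableOn_compact hK) (half_pos one_pos) hsuppK (fun s hs => ?_)
  have h0 := hint 0 (by norm_num)
  have hs' := hint s hs
  simp only [zero_smul, add_zero] at h0
  have hpos : 0 < 1 + s := by
    have := (abs_lt.1 hs).1
    linarith
  rw [Measure.volume_eq_prod] at h0 hs' ⊢
  rw [integral_prod _ h0, integral_prod _ hs']
  refine integral_congr_ae (Filter.Eventually.of_forall fun x => ?_)
  have hadd : ∀ t : EuclideanSpace ℝ (Fin m),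
      (((x, t) : Pt d m) + s • ((0, t) : Pt d m)) = (x, (1 + s) • t) := fun t => by
    ext1 <;> simp [add_smul]
  simp only [hadd]
  exact integral_inv_norm_pow_mul_comp_smul hpos fun t => φ (x, t)

theorem measurable_indicator_inv {h : ℝ → ℝ} (hcont : ContinuousOn h (Ioi 0))
    (hpos : ∀ s, 0 < s → 0 < h s) : Measurable ((Ioi 0).indicator fun s => (h s)⁻¹) := by
  classical
  rw [← piecewise_eq_indicator]
  exact (hcont.inv₀ fun s hs => (hpos s hs).ne').measurable_piecewise continuousOn_const
    measurableSet_Ioi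

theorem abs_indicator_inv_le {h : ℝ → ℝ} {C : ℝ} (hC : 0 < C)
    (hlb : ∀ s : ℝ, 0 < s → C⁻¹ ≤ h s) (s : ℝ) :
    |(Ioi 0).indicator (fun s => (h s)⁻¹) s| ≤ C := by
  by_cases hs : s ∈ Ioi (0 : ℝ)
  · have hh := hlb s hs
    have h0 : 0 < h s := (inv_pos.2 hC).trans_le hh
    rw [indicator_of_mem hs, abs_of_pos (inv_pos.2 h0)]
    exact inv_le_of_inv_le₀ hC hh
  · rw [indicator_of_notMem hs, abs_zero]
    exact hC.le

theorem intervalIntegrable_indicator_inv {h : ℝ → ℝ} {C : ℝ} (hC : 0 < C)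
    (hcont : ContinuousOn h (Ioi 0)) (hlb : ∀ s : ℝ, 0 < s → C⁻¹ ≤ h s) (a b : ℝ) :
    IntervalIntegrable ((Ioi 0).indicator fun s => (h s)⁻¹) volume a b :=
  (intervalIntegrable_const (c := C)).mono_fun
    (measurable_indicator_inv hcont fun s hs =>
      (inv_pos.2 hC).trans_le (hlb s hs)).aestronglyMeasurable
    (Filter.Eventually.of_forall fun s => by
      simpa [Real.norm_eq_abs, abs_of_pos hC] using abs_indicator_inv_le hC hlb s)

theorem integral_inv_eq_integral_indicator (h : ℝ → ℝ) {r : ℝ} (hr : 0 ≤ r) :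
    ∫ s in (0 : ℝ)..r, (h s)⁻¹ = ∫ s in (0 : ℝ)..r, (Ioi 0).indicator (fun s => (h s)⁻¹) s := by
  rw [intervalIntegral.integral_of_le hr, intervalIntegral.integral_of_le hr]
  refine setIntegral_congr_fun measurableSet_Ioc fun s hs => ?_
  rw [indicator_of_mem (mem_Ioi.2 hs.1)]

theorem hasDerivAt_integral_indicator_inv {h : ℝ → ℝ} {C : ℝ} (hC : 0 < C)
    (hcont : ContinuousOn h (Ioi 0)) (hlb : ∀ s : ℝ, 0 < s → C⁻¹ ≤ h s) {r : ℝ} (hr : 0 < r) :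
    HasDerivAt (fun r => ∫ s in (0 : ℝ)..r, (Ioi 0).indicator (fun s => (h s)⁻¹) s)
      (h r)⁻¹ r := by
  have hpos : ∀ s, 0 < s → 0 < h s := fun s hs => (inv_pos.2 hC).trans_le (hlb s hs)
  have hcts : ContinuousAt ((Ioi 0).indicator fun s => (h s)⁻¹) r := by
    refine ((hcont.continuousAt (Ioi_mem_nhds hr)).inv₀ (hpos r hr).ne').congr ?_
    filter_upwards [Ioi_mem_nhds hr] with s hs
    rw [indicator_of_mem hs, Pi.inv_apply]
  have := intervalIntegral.integral_hasDerivAt_right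
    (intervalIntegrable_indicator_inv hC hcont hlb 0 r)
    (measurable_indicator_inv hcont hpos).stronglyMeasurable.stronglyMeasurableAtFilter hcts
  rwa [indicator_of_mem (mem_Ioi.2 hr)] at this

theorem integral_inv_bounds {h : ℝ → ℝ} {C : ℝ} (hC : 0 < C)
    (hcont : ContinuousOn h (Ioi 0)) (hlb : ∀ s : ℝ, 0 < s → C⁻¹ ≤ h s)
    (hub : ∀ s : ℝ, 0 < s → h s ≤ C) {r : ℝ} (hr : 0 ≤ r) :
    C⁻¹ * r ≤ ∫ s in (0 : ℝ)..r, (h s)⁻¹ ∧ ∫ s in (0 : ℝ)..r, (h s)⁻¹ ≤ C * r := by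
  have hpos : ∀ s, 0 < s → 0 < h s := fun s hs => (inv_pos.2 hC).trans_le (hlb s hs)
  have hint := intervalIntegrable_indicator_inv hC hcont hlb 0 r
  rw [integral_inv_eq_integral_indicator h hr]
  constructor
  · have := intervalIntegral.integral_mono_on_of_le_Ioo hr
      (intervalIntegrable_const (c := C⁻¹)) hint fun s hs => by
        rw [indicator_of_mem (mem_Ioi.2 hs.1)]
        exact inv_anti₀ (hpos s hs.1) (hub s hs.1)
    simpa [mul_comm] using this
  · have := intervalIntegral.integral_mono_on_of_le_Ioo hr hint
      (intervalIntegrable_const (c := C)) fun s _ =>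
        (le_abs_self _).trans (abs_indicator_inv_le hC hlb s)
    simpa [mul_comm] using this

theorem contDiffOn_integral_indicator_inv {h : ℝ → ℝ} {C : ℝ} (hC : 0 < C)
    (hcont : ContinuousOn h (Ioi 0)) (hlb : ∀ s : ℝ, 0 < s → C⁻¹ ≤ h s) :
    ContDiffOn ℝ 1 (fun r => ∫ s in (0 : ℝ)..r, (Ioi 0).indicator (fun s => (h s)⁻¹) s)
      (Ioi 0) := by
  have hd := fun r (hr : r ∈ Ioi (0 : ℝ)) => hasDerivAt_integral_indicator_inv hC hcont hlb hr
  rw [contDiffOn_one_iff_derivWithin (uniqueDiffOn_Ioi 0)]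
  refine ⟨fun r hr => (hd r hr).differentiableAt.differentiableWithinAt, ?_⟩
  refine (hcont.inv₀ fun s hs => ((inv_pos.2 hC).trans_le (hlb s hs)).ne').congr fun r hr => ?_
  exact (hd r hr).hasDerivWithinAt.derivWithin (uniqueDiffOn_Ioi 0 r hr)

theorem hasFDerivAt_comp_norm_snd {d m : ℕ} {F : ℝ → ℝ} {F' : ℝ} {P : Pt d m} (hP : P.2 ≠ 0)
    (hF : HasDerivAt F F' ‖P.2‖) :
    HasFDerivAt (fun Q : Pt d m => F ‖Q.2‖)
      ((F' * ‖P.2‖⁻¹) • (innerSL ℝ P.2).comp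
        (ContinuousLinearMap.snd ℝ (EuclideanSpace ℝ (Fin d)) (EuclideanSpace ℝ (Fin m)))) P := by
  have h0 : ‖P.2‖ ≠ 0 := norm_ne_zero_iff.2 hP
  have h1 : HasFDerivAt (fun Q : Pt d m => ‖Q.2‖ ^ 2)
      ((2 • innerSL ℝ P.2).comp
        (ContinuousLinearMap.snd ℝ (EuclideanSpace ℝ (Fin d)) (EuclideanSpace ℝ (Fin m)))) P :=
    (hasStrictFDerivAt_norm_sq P.2).hasFDerivAt.comp P hasFDerivAt_snd
  have h2 := h1.sqrt (pow_ne_zero 2 h0)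
  simp only [Real.sqrt_sq (norm_nonneg _)] at h2
  refine (hF.comp_hasFDerivAt P h2).congr_fderiv ?_
  ext v <;> (simp; try field_simp)

theorem pdx_comp_norm_snd {d m : ℕ} {F : ℝ → ℝ} {F' : ℝ} {P : Pt d m} (hP : P.2 ≠ 0)
    (hF : HasDerivAt F F' ‖P.2‖) (j : Fin d) : pdx (fun Q : Pt d m => F ‖Q.2‖) P j = 0 := by
  simp [pdx, (hasFDerivAt_comp_norm_snd hP hF).fderiv]

theorem pdt_comp_norm_snd {d m : ℕ} {F : ℝ → ℝ} {F' : ℝ} {P : Pt d m} (hP : P.2 ≠ 0)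
    (hF : HasDerivAt F F' ‖P.2‖) (i : Fin m) :
    pdt (fun Q : Pt d m => F ‖Q.2‖) P i = F' * (P.2 i / ‖P.2‖) := by
  simp [pdt, (hasFDerivAt_comp_norm_snd hP hF).fderiv, EuclideanSpace.inner_single_right]
  ring

theorem sum_mul_pdt {d m : ℕ} (φ : Pt d m → ℝ) (P : Pt d m) (t : EuclideanSpace ℝ (Fin m)) :
    ∑ i, t i * pdt φ P i = fderiv ℝ φ P (0, t) := by
  have ht : ((0, t) : Pt d m) = ∑ i, t i • ((0, EuclideanSpace.single i 1) : Pt d m) := by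
    ext1
    · simp [Prod.fst_sum]
    · ext k
      simp [Prod.snd_sum, Pi.single_apply]
  rw [ht, map_sum]
  simp only [map_smul, smul_eq_mul, pdt]

theorem abs_div_norm_le_one {m : ℕ} (t : EuclideanSpace ℝ (Fin m)) (i : Fin m) :
    |t i / ‖t‖| ≤ 1 := by
  rw [abs_div, abs_norm]
  exact div_le_one_of_le₀ (PiLp.norm_apply_le t i) (norm_nonneg t)

/-- The `j`-th horizontal coefficient of `|t|^{1-m} 𝒜ᵀ∇u`, where `u` depends only on `|t|` and has
radial derivative `g`, extended by zero outside `Ω`. -/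
def horizontalFlux {d m : ℕ} (A : Pt d m → Matrix (Fin d ⊕ Fin m) (Fin d ⊕ Fin m) ℝ) (g : ℝ → ℝ)
    (j : Fin d) : Pt d m → ℝ :=
  (Omega d m).indicator fun P => ‖P.2‖ ^ ((1 : ℝ) - (m : ℝ)) *
    ((∑ i, A P (Sum.inr i) (Sum.inl j) * (P.2 i / ‖P.2‖)) * g ‖P.2‖)

section horizontalFlux

variable {d m : ℕ} {A : Pt d m → Matrix (Fin d ⊕ Fin m) (Fin d ⊕ Fin m) ℝ} {g : ℝ → ℝ}

theorem measurable_horizontalFlux (hA : ∀ i j, Measurable fun P => A P i j) (hg : Measurable g)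
    (j : Fin d) : Measurable (horizontalFlux A g j) := by
  refine Measurable.indicator ?_ (isOpen_Omega d m).measurableSet
  have h1 : Measurable fun P : Pt d m => ‖P.2‖ ^ ((1 : ℝ) - (m : ℝ)) :=
    measurable_snd.norm.pow_const _
  have h2 : ∀ i : Fin m, Measurable fun P : Pt d m => P.2 i / ‖P.2‖ := fun i =>
    Measurable.div (by fun_prop) (by fun_prop)
  exact h1.mul ((Finset.measurable_sum _ fun i _ => (hA _ _).mul (h2 i)).mul
    (hg.comp measurable_snd.norm))

theorem integrableOn_horizontalFlux (hA : ∀ i j, Measurable fun P => A P i j)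
    (hg : Measurable g) {C M : ℝ} (hgC : ∀ s, |g s| ≤ C)
    (hM : ∀ P ∈ Omega d m, ∀ i j, |A P i j| ≤ M) (j : Fin d) {K : Set (Pt d m)}
    (hKO : K ⊆ Omega d m) (hK : IsCompact K) : IntegrableOn (horizontalFlux A g j) K := by
  have hcont : ContinuousOn (fun P : Pt d m => ‖P.2‖ ^ ((1 : ℝ) - (m : ℝ))) K :=
    ContinuousOn.rpow_const (by fun_prop) fun P hP => Or.inl (norm_ne_zero_iff.2 (hKO hP).1)
  obtain ⟨B, hB⟩ := hK.exists_bound_of_continuousOn hcont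
  refine Measure.integrableOn_of_bounded (M := B * ((∑ _i : Fin m, M * 1) * C))
    hK.measure_lt_top.ne (measurable_horizontalFlux hA hg j).aestronglyMeasurable
    ((ae_restrict_iff' hK.measurableSet).2 (Filter.Eventually.of_forall fun P hP => ?_))
  have hB0 : 0 ≤ B := (norm_nonneg _).trans (hB P hP)
  have hsum : |∑ i, A P (Sum.inr i) (Sum.inl j) * (P.2 i / ‖P.2‖)| ≤ ∑ _i : Fin m, M * 1 := by
    refine (Finset.abs_sum_le_sum_abs _ _).trans (Finset.sum_le_sum fun i _ => ?_)
    have hMP := hM P (hKO hP) (Sum.inr i) (Sum.inl j)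
    rw [abs_mul]
    exact mul_le_mul hMP (abs_div_norm_le_one P.2 i) (abs_nonneg _) ((abs_nonneg _).trans hMP)
  rw [horizontalFlux, indicator_of_mem (hKO hP), norm_mul, norm_mul]
  exact mul_le_mul (hB P hP) (mul_le_mul hsum (hgC _) (abs_nonneg _) ((abs_nonneg _).trans hsum))
    (by positivity) hB0

theorem horizontalFlux_add_horizontal
    (hA3 : ∀ (x x' : EuclideanSpace ℝ (Fin d)) (t : EuclideanSpace ℝ (Fin m)),
      ((x, t) : Pt d m) ∈ Omega d m → ∀ j : Fin d,
        (∑ i, A (x, t) (Sum.inr i) (Sum.inl j) * (t i / ‖t‖)) =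
          ∑ i, A (x', t) (Sum.inr i) (Sum.inl j) * (t i / ‖t‖))
    (j : Fin d) (P : Pt d m) (y : EuclideanSpace ℝ (Fin d)) :
    horizontalFlux A g j (P + (y, 0)) = horizontalFlux A g j P := by
  obtain ⟨x, t⟩ := P
  have hadd : ((x, t) : Pt d m) + (y, 0) = (x + y, t) := by simp
  rw [hadd]
  by_cases ht : t ∈ TSet m
  · have h1 : ((x + y, t) : Pt d m) ∈ Omega d m := ht
    have h2 : ((x, t) : Pt d m) ∈ Omega d m := ht
    rw [horizontalFlux, indicator_of_mem h1, indicator_of_mem h2]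
    simp only
    rw [hA3 (x + y) x t h1 j]
  · have h1 : ((x + y, t) : Pt d m) ∉ Omega d m := ht
    have h2 : ((x, t) : Pt d m) ∉ Omega d m := ht
    rw [horizontalFlux, indicator_of_notMem h1, indicator_of_notMem h2]

end horizontalFlux

theorem weighted_conormal_eq {d m : ℕ} {A : Matrix (Fin d ⊕ Fin m) (Fin d ⊕ Fin m) ℝ}
    {v : Fin d ⊕ Fin m → ℝ} {φ : Pt d m → ℝ} {P : Pt d m} {a : ℝ} (ha : a ≠ 0) (hP : P.2 ≠ 0)
    (hvl : ∀ k, v (Sum.inl k) = 0) (hvr : ∀ i, v (Sum.inr i) = a⁻¹ * (P.2 i / ‖P.2‖))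
    (hA4 : ∀ i, (∑ k, A (Sum.inr k) (Sum.inr i) * (P.2 k / ‖P.2‖)) = a * (P.2 i / ‖P.2‖)) :
    ‖P.2‖ ^ ((1 : ℝ) - (m : ℝ)) * (∑ i, (∑ j, A.transpose i j * v j) * grad φ P i) =
      ∑ j, ‖P.2‖ ^ ((1 : ℝ) - (m : ℝ)) *
          ((∑ i, A (Sum.inr i) (Sum.inl j) * (P.2 i / ‖P.2‖)) * a⁻¹) *
          fderiv ℝ φ P (EuclideanSpace.single j 1, 0) +
        (‖P.2‖ ^ m)⁻¹ * fderiv ℝ φ P (0, P.2) := by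
  have hn : 0 < ‖P.2‖ := norm_pos_iff.2 hP
  have hrow : ∀ i, ∑ j, A.transpose i j * v j =
      (∑ k, A (Sum.inr k) i * (P.2 k / ‖P.2‖)) * a⁻¹ := fun i => by
    rw [Fintype.sum_sum_type, Finset.sum_mul]
    simp only [hvl, hvr, mul_zero, Finset.sum_const_zero, zero_add, Matrix.transpose_apply]
    exact Finset.sum_congr rfl fun k _ => by ring
  have hpow : ‖P.2‖ ^ ((1 : ℝ) - (m : ℝ)) = ‖P.2‖ * (‖P.2‖ ^ m)⁻¹ := by
    rw [Real.rpow_sub hn, Real.rpow_one, Real.rpow_natCast, div_eq_mul_inv]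
  rw [Fintype.sum_sum_type, mul_add]
  simp only [hrow, hA4]
  congr 1
  · rw [Finset.mul_sum]
    exact Finset.sum_congr rfl fun j _ => by simp [grad, pdx, mul_assoc]
  · rw [← sum_mul_pdt, Finset.mul_sum, Finset.mul_sum, hpow]
    refine Finset.sum_congr rfl fun i _ => ?_
    simp only [grad, Sum.elim_inr]
    field_simp

theorem isWeakSolOn_radial_primitive {d m : ℕ} {C : ℝ} (hC : 0 < C) {h : ℝ → ℝ}
    (hcont : ContinuousOn h (Ioi 0)) (hlb : ∀ s : ℝ, 0 < s → C⁻¹ ≤ h s)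
    {A : Pt d m → Matrix (Fin d ⊕ Fin m) (Fin d ⊕ Fin m) ℝ}
    (hAmeas : ∀ i j, Measurable fun P => A P i j)
    (hAbdd : ∃ M : ℝ, ∀ P ∈ Omega d m, ∀ i j, |A P i j| ≤ M)
    (hA3 : ∀ (x x' : EuclideanSpace ℝ (Fin d)) (t : EuclideanSpace ℝ (Fin m)),
      ((x, t) : Pt d m) ∈ Omega d m → ∀ j : Fin d,
        (∑ i, A (x, t) (Sum.inr i) (Sum.inl j) * (t i / ‖t‖)) =
          ∑ i, A (x', t) (Sum.inr i) (Sum.inl j) * (t i / ‖t‖))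
    (hA4 : ∀ P ∈ Omega d m, ∀ i : Fin m,
      (∑ k, A P (Sum.inr k) (Sum.inr i) * (P.2 k / ‖P.2‖)) = h ‖P.2‖ * (P.2 i / ‖P.2‖)) :
    IsWeakSolOn d m (fun P => (A P).transpose)
      (fun P => ∫ s in (0 : ℝ)..‖P.2‖, (Ioi 0).indicator (fun s => (h s)⁻¹) s)
      (Omega d m) := by
  rintro φ ⟨L, hφ⟩ hc hsub
  obtain ⟨M, hM⟩ := hAbdd
  have hpos : ∀ s, 0 < s → 0 < h s := fun s hs => (inv_pos.2 hC).trans_le (hlb s hs)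
  set g : ℝ → ℝ := (Ioi 0).indicator fun s => (h s)⁻¹ with hg_def
  have hg : Measurable g := measurable_indicator_inv hcont hpos
  have hhor := fun j : Fin d => integral_mul_fderiv_horizontal_eq_zero hφ hc hsub
    (measurable_horizontalFlux hAmeas hg j)
    (fun K hKO hK => integrableOn_horizontalFlux hAmeas hg (abs_indicator_inv_le hC hlb) hM j hKO hK)
    (horizontalFlux_add_horizontal hA3 j) (EuclideanSpace.single j 1)
  have hrad := integral_fderiv_radial_eq_zero hφ hc hsub
  rw [setIntegral_congr_fun (isOpen_Omega d m).measurableSet (g := fun P =>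
      ∑ j, horizontalFlux A g j P * fderiv ℝ φ P (EuclideanSpace.single j 1, 0) +
        (‖P.2‖ ^ m)⁻¹ * fderiv ℝ φ P (0, P.2)) ?_,
    setIntegral_eq_integral_of_forall_compl_eq_zero ?_,
    integral_add (integrable_finsetSum _ fun j _ => (hhor j).1) hrad.1,
    integral_finsetSum _ fun j _ => (hhor j).1, hrad.2]
  · simp [fun j => (hhor j).2]
  · intro P hP
    have : fderiv ℝ φ P = 0 :=
      image_eq_zero_of_notMem_tsupport fun hmem => hP (hsub (tsupport_fderiv_subset ℝ hmem))
    simp [this]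
  · intro P hP
    have hn : 0 < ‖P.2‖ := norm_pos_iff.2 hP.1
    have hF := hasDerivAt_integral_indicator_inv hC hcont hlb hn
    simp only
    rw [weighted_conormal_eq (hpos _ hn).ne' hP.1 (pdx_comp_norm_snd hP.1 hF)
      (pdt_comp_norm_snd hP.1 hF) (hA4 P hP)]
    simp only [horizontalFlux, indicator_of_mem hP, hg_def, indicator_of_mem (mem_Ioi.2 hn)]

/-- Lemma 3.1, Case 2 / hypothesis (H2) of the paper.
If the bottom rows of `𝒜` satisfy (H2) with profile `h`, then
`u(x,t) = ∫₀^{|t|} h(s)⁻¹ ds` is (the) Green function with pole at infinity: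
it is `C¹` in `Ω`, continuous up to the boundary, vanishes exactly on `{t = 0}`,
is comparable to `|t|`, and is a weak solution of `L* u = 0` in `Ω`. -/
theorem statement0 (d n : ℕ) (hd : 1 ≤ d) (hdn : d < n) (C : ℝ) (hC : 1 ≤ C)
    (h : ℝ → ℝ) (hcont : ContinuousOn h (Ioi 0))
    (hlb : ∀ s : ℝ, 0 < s → C⁻¹ ≤ h s) (hub : ∀ s : ℝ, 0 < s → h s ≤ C)
    (u : Pt d (n - d) → ℝ)
    (hu : ∀ P : Pt d (n - d), u P = ∫ s in (0 : ℝ)..‖P.2‖, (h s)⁻¹)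
    (A : Pt d (n - d) → Matrix (Fin d ⊕ Fin (n - d)) (Fin d ⊕ Fin (n - d)) ℝ)
    (hAmeas : ∀ i j, Measurable fun P => A P i j)
    (hAbdd : ∃ M : ℝ, ∀ P ∈ Omega d (n - d), ∀ i j, |A P i j| ≤ M)
    -- the vector `𝒜₃(x,t)ᵀ (t/|t|) ∈ ℝ^d` does not depend on `x`
    (hA3 : ∀ (x x' : EuclideanSpace ℝ (Fin d)) (t : EuclideanSpace ℝ (Fin (n - d))),
      ((x, t) : Pt d (n - d)) ∈ Omega d (n - d) → ∀ j : Fin d,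
        (∑ i, A (x, t) (Sum.inr i) (Sum.inl j) * (t i / ‖t‖)) =
          ∑ i, A (x', t) (Sum.inr i) (Sum.inl j) * (t i / ‖t‖))
    -- `𝒜₄(x,t)ᵀ (t/|t|) = h(|t|) (t/|t|)`
    (hA4 : ∀ P ∈ Omega d (n - d), ∀ i : Fin (n - d),
      (∑ k, A P (Sum.inr k) (Sum.inr i) * (P.2 k / ‖P.2‖)) = h ‖P.2‖ * (P.2 i / ‖P.2‖)) :
    (ContDiffOn ℝ 1 u (Omega d (n - d)) ∧
      ContinuousOn u (closure (Omega d (n - d))) ∧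
      (∀ P : Pt d (n - d), u P = 0 ↔ P.2 = 0) ∧
      (∀ P : Pt d (n - d), C⁻¹ * ‖P.2‖ ≤ u P ∧ u P ≤ C * ‖P.2‖)) ∧
    IsWeakSolOn d (n - d) (fun P => (A P).transpose) u (Omega d (n - d)) := by
  have hC0 : 0 < C := one_pos.trans_le hC
  have hu' : u = fun P =>
      ∫ s in (0 : ℝ)..‖P.2‖, (Ioi 0).indicator (fun s => (h s)⁻¹) s :=
    funext fun P => (hu P).trans (integral_inv_eq_integral_indicator h (norm_nonneg _))
  have hbounds : ∀ P : Pt d (n - d), C⁻¹ * ‖P.2‖ ≤ u P ∧ u P ≤ C * ‖P.2‖ := fun P => by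
    rw [hu P]
    exact integral_inv_bounds hC0 hcont hlb hub (norm_nonneg _)
  refine ⟨⟨?_, ?_, fun P => ⟨fun hP => ?_, fun hP => ?_⟩, hbounds⟩, ?_⟩
  · rw [hu']
    refine (contDiffOn_integral_indicator_inv hC0 hcont hlb).comp (fun P hP => ?_)
      fun P hP => norm_pos_iff.2 hP.1
    exact (contDiffAt_snd.norm ℝ hP.1).contDiffWithinAt
  · rw [hu']
    exact ((intervalIntegral.continuous_primitive
      (intervalIntegrable_indicator_inv hC0 hcont hlb) 0).comp
        continuous_snd.norm).continuousOn
  · have h1 := (hbounds P).1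
    rw [hP] at h1
    exact norm_le_zero_iff.1 (nonpos_of_mul_nonpos_right h1 (inv_pos.2 hC0))
  · rw [hu P, hP, norm_zero, intervalIntegral.integral_same]
  · rw [hu']
    exact isWeakSolOn_radial_primitive hC0 hcont hlb hAmeas hAbdd hA3 hA4
end
end

section
/- There is a constant $C$ depending only on $n$ and $d$ such that for every ball $B\subset\mathbb{R}^d$, every $\epsilon>0$, and every continuous function $v:\Omega\to\mathbb{R}$, one has $\int_\Omega \big(|t|\,|\nabla\Psi_{B,\epsilon}(y,t)|+|t|^2|\nabla\Psi_{B,\epsilon}(y,t)|^2\big)\,v(y,t)^2\,\frac{dt\,dy}{|t|^{n-d}}\ \le\ C\,\|\widetilde N(v)\|_{L^2(\mathbb{R}^d)}^2$, where $\nabla\Psi_{B,\epsilon}$ denotes the almost-everywhere defined gradient of the locally Lipschitz function $\Psi_{B,\epsilon}$. -/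
open MeasureTheory Metric Set
open scoped ENNReal NNReal

noncomputable section

/-- The vertical shell `{h(y) ≤ |t| ≤ 2 h(y)}` over the graph of `h`. -/
def shell (d m : ℕ) (h : EuclideanSpace ℝ (Fin d) → ℝ) : Set (Pt d m) :=
  {P | h P.1 ≤ ‖P.2‖ ∧ ‖P.2‖ ≤ 2 * h P.1}

namespace cutoffProps

variable {φ : ℝ → ℝ}

lemma abs_sub_le (hφ : cutoffProps φ) (x y : ℝ) : |φ y - φ x| ≤ 2 * |y - x| := by
  obtain ⟨hs, -, -, -, hd⟩ := hφ
  exact convex_univ.norm_image_sub_le_of_norm_deriv_le (𝕜 := ℝ) (f := φ)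
    (fun z _ => (hs.differentiable (by simp)) z)
    (fun z _ => hd z) (mem_univ x) (mem_univ y)

lemma eventually_eq_zero (hφ : cutoffProps φ) {E : Type*} [TopologicalSpace E] {ρ : E → ℝ} {P : E}
    (hρ : ContinuousAt ρ P) (h : 2 < ρ P) : ∀ᶠ Q in nhds P, φ (ρ Q) = 0 := by
  filter_upwards [hρ.eventually (lt_mem_nhds h)] with Q hQ using hφ.2.2.2.1 _ hQ.le

lemma eventually_eq_const (hφ : cutoffProps φ) {E : Type*} [TopologicalSpace E] {ρ : E → ℝ} {P : E}
    (hρ : ContinuousAt ρ P) (h0 : 0 ≤ ρ P) (h : ρ P ∉ Icc (1 : ℝ) 2) :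
    ∃ c, ∀ᶠ Q in nhds P, φ (ρ Q) = c := by
  rcases lt_or_ge (ρ P) 1 with h1 | h1
  · refine ⟨1, ?_⟩
    filter_upwards [hρ.eventually (Ioo_mem_nhds (by linarith : (-1 : ℝ) < ρ P) h1)] with Q hQ
      using hφ.2.2.1 _ hQ
  · exact ⟨0, hφ.eventually_eq_zero hρ (not_le.1 fun h2 => h ⟨h1, h2⟩)⟩

end cutoffProps

lemma abs_mul_mul_sub_le {a b c a' b' c' : ℝ} (hb' : 0 ≤ b' ∧ b' ≤ 1)
    (hb : 0 ≤ b ∧ b ≤ 1) (ha' : 0 ≤ a' ∧ a' ≤ 1) (hc : 0 ≤ c ∧ c ≤ 1) :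
    |a * b * c - a' * b' * c'| ≤ |a - a'| + |b - b'| + |c - c'| := by
  have e : a * b * c - a' * b' * c' = (a - a') * (b * c) + (b - b') * (a' * c)
      + (c - c') * (a' * b') := by ring
  rw [e]
  refine (abs_add_three _ _ _).trans ?_
  simp only [abs_mul, abs_of_nonneg hb.1, abs_of_nonneg hc.1,
    abs_of_nonneg ha'.1, abs_of_nonneg hb'.1]
  gcongr
  · exact mul_le_of_le_one_right (abs_nonneg _) (mul_le_one₀ hb.2 hc.1 hc.2)
  · exact mul_le_of_le_one_right (abs_nonneg _) (mul_le_one₀ ha'.2 hc.1 hc.2)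
  · exact mul_le_of_le_one_right (abs_nonneg _) (mul_le_one₀ ha'.2 hb'.1 hb'.2)

section Gradient

variable {d m : ℕ} {φ : ℝ → ℝ} (xB : EuclideanSpace ℝ (Fin d)) {r ε : ℝ} {P : Pt d m}

lemma continuousAt_infDist_div (hP : P.2 ≠ 0) :
    ContinuousAt (fun Q : Pt d m => infDist Q.1 (ball xB r) / ‖Q.2‖) P := by
  have h : Continuous fun Q : Pt d m => infDist Q.1 (ball xB r) :=
    (continuous_infDist_pt _).comp continuous_fst
  exact h.continuousAt.div (by fun_prop) (by simpa using hP)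

lemma continuousAt_div_norm (hP : P.2 ≠ 0) :
    ContinuousAt (fun Q : Pt d m => ε / ‖Q.2‖) P :=
  continuousAt_const.div (by fun_prop) (by simpa using hP)

lemma fderiv_PsiBe_eq_zero (hφ : cutoffProps φ) (hr : 0 < r) (hε : 0 < ε) (hP : P.2 ≠ 0)
    (h1 : P ∉ shell d m (fun y => infDist y (ball xB r) / 2))
    (h2 : P ∉ shell d m (fun _ => r)) (h3 : P ∉ shell d m (fun _ => ε / 2)) :
    fderiv ℝ (PsiBe d m φ xB r ε) P = 0 := by
  have ht : 0 < ‖P.2‖ := norm_pos_iff.2 hP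
  simp only [shell, mem_ofPred_eq] at h1 h2 h3
  obtain ⟨a, ha⟩ := hφ.eventually_eq_const (continuousAt_infDist_div xB (r := r) hP)
    (div_nonneg infDist_nonneg ht.le) (by
      rintro ⟨h, h'⟩
      rw [le_div_iff₀ ht] at h; rw [div_le_iff₀ ht] at h'
      exact h1 ⟨by linarith, by linarith⟩)
  obtain ⟨b, hb⟩ := hφ.eventually_eq_const (ρ := fun Q : Pt d m => ‖Q.2‖ / r) (P := P)
    (by fun_prop) (by positivity) (by
      rintro ⟨h, h'⟩
      rw [le_div_iff₀ hr] at h; rw [div_le_iff₀ hr] at h'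
      exact h2 ⟨by linarith, by linarith⟩)
  obtain ⟨c, hc⟩ := hφ.eventually_eq_const (continuousAt_div_norm (ε := ε) hP)
    (by positivity) (by
      rintro ⟨h, h'⟩
      rw [le_div_iff₀ ht] at h; rw [div_le_iff₀ ht] at h'
      exact h3 ⟨by linarith, by linarith⟩)
  have : PsiBe d m φ xB r ε =ᶠ[nhds P] fun _ => a * b * c := by
    filter_upwards [ha, hb, hc] with Q h h' h''
    simp only [PsiBe, PsiB, h, h', h'']
  rw [this.fderiv_eq]
  simp

lemma norm_fderiv_PsiBe_le (hφ : cutoffProps φ) (hr : 0 < r) (hε : 0 < ε) (hP : P.2 ≠ 0) :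
    ‖fderiv ℝ (PsiBe d m φ xB r ε) P‖ ≤ 24 / ‖P.2‖ := by
  have ht : 0 < ‖P.2‖ := norm_pos_iff.2 hP
  have key : (PsiBe d m φ xB r ε =ᶠ[nhds P] fun _ => 0) →
      ‖fderiv ℝ (PsiBe d m φ xB r ε) P‖ ≤ 24 / ‖P.2‖ := by
    intro h
    rw [h.fderiv_eq]
    simp only [fderiv_fun_const, Pi.zero_apply, norm_zero]
    positivity
  rcases lt_or_ge 2 (infDist P.1 (ball xB r) / ‖P.2‖) with h1 | h1
  · apply key
    filter_upwards [hφ.eventually_eq_zero (continuousAt_infDist_div xB (r := r) hP) h1] with Q hQ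
    simp [PsiBe, PsiB, hQ]
  rcases lt_or_ge 2 (‖P.2‖ / r) with h2 | h2
  · apply key
    filter_upwards [hφ.eventually_eq_zero (ρ := fun Q : Pt d m => ‖Q.2‖ / r) (P := P)
      (by fun_prop) h2] with Q hQ
    simp [PsiBe, PsiB, hQ]
  rcases lt_or_ge 2 (ε / ‖P.2‖) with h3 | h3
  · apply key
    filter_upwards [hφ.eventually_eq_zero (continuousAt_div_norm (ε := ε) hP) h3] with Q hQ
    simp [PsiBe, hQ]
  refine norm_fderiv_le_of_lip' ℝ (by positivity) ?_
  filter_upwards [(continuous_snd.norm (E := EuclideanSpace ℝ (Fin m))).continuousAt.eventually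
    (lt_mem_nhds (half_lt_self ht))] with Q hQ
  have hQ0 : 0 < ‖Q.2‖ := by linarith
  set δ := ‖Q - P‖
  have hδ0 : 0 ≤ δ := norm_nonneg _
  have hδ1 : ‖Q.1 - P.1‖ ≤ δ := norm_fst_le (Q - P)
  have hδ2 : |‖Q.2‖ - ‖P.2‖| ≤ δ := (abs_norm_sub_norm_le _ _).trans (norm_snd_le (Q - P))
  have inv : ∀ a : ℝ, 0 ≤ a → a / ‖P.2‖ ≤ 2 → |a / ‖Q.2‖ - a / ‖P.2‖| ≤ 4 / ‖P.2‖ * δ := by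
    intro a ha ha2
    have e : a / ‖Q.2‖ - a / ‖P.2‖ = (a / ‖P.2‖) * (‖Q.2‖)⁻¹ * (‖P.2‖ - ‖Q.2‖) := by
      field_simp
    have e' : (‖Q.2‖)⁻¹ ≤ 2 / ‖P.2‖ := by
      rw [inv_le_comm₀ hQ0 (by positivity), inv_div]; exact hQ.le
    rw [e, abs_mul, abs_mul, abs_of_nonneg (by positivity : 0 ≤ a / ‖P.2‖),
      abs_of_pos (inv_pos.2 hQ0), abs_sub_comm]
    calc _ ≤ 2 * (2 / ‖P.2‖) * δ := by gcongr
      _ = _ := by ring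
  have b1 : |infDist Q.1 (ball xB r) / ‖Q.2‖ - infDist P.1 (ball xB r) / ‖P.2‖|
      ≤ 6 / ‖P.2‖ * δ := by
    have h := inv _ (infDist_nonneg (x := P.1) (s := ball xB r)) h1
    have e' : (‖Q.2‖)⁻¹ ≤ 2 / ‖P.2‖ := by
      rw [inv_le_comm₀ hQ0 (by positivity), inv_div]; exact hQ.le
    have hD : |infDist Q.1 (ball xB r) - infDist P.1 (ball xB r)| ≤ δ := by
      have := (lipschitz_infDist_pt (ball xB r)).dist_le_mul Q.1 P.1
      rw [Real.dist_eq, dist_eq_norm] at this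
      simp only [NNReal.coe_one, one_mul] at this
      exact this.trans hδ1
    have e : infDist Q.1 (ball xB r) / ‖Q.2‖ - infDist P.1 (ball xB r) / ‖P.2‖
      = (infDist Q.1 (ball xB r) - infDist P.1 (ball xB r)) * (‖Q.2‖)⁻¹ +
        (infDist P.1 (ball xB r) / ‖Q.2‖ - infDist P.1 (ball xB r) / ‖P.2‖) := by
      ring
    rw [e]
    refine (abs_add_le _ _).trans ?_
    rw [abs_mul, abs_of_pos (inv_pos.2 hQ0)]
    calc _ ≤ δ * (2 / ‖P.2‖) + 4 / ‖P.2‖ * δ := by gcongr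
      _ = _ := by ring
  have b2 : |‖Q.2‖ / r - ‖P.2‖ / r| ≤ 2 / ‖P.2‖ * δ := by
    rw [← sub_div, abs_div, abs_of_pos hr, div_eq_inv_mul]
    have : r⁻¹ ≤ 2 / ‖P.2‖ := by
      rw [div_le_iff₀ hr] at h2
      rw [inv_le_comm₀ hr (by positivity), inv_div]; linarith
    gcongr
  have b3 := inv ε hε.le h3
  rw [Real.norm_eq_abs]
  refine (abs_mul_mul_sub_le (hφ.2.1 _) (hφ.2.1 _) (hφ.2.1 _) (hφ.2.1 _)).trans ?_
  calc _ ≤ 2 * (6 / ‖P.2‖ * δ) + 2 * (2 / ‖P.2‖ * δ) + 2 * (4 / ‖P.2‖ * δ) := by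
        gcongr
        · exact (hφ.abs_sub_le _ _).trans (by gcongr)
        · exact (hφ.abs_sub_le _ _).trans (by gcongr)
        · exact (hφ.abs_sub_le _ _).trans (by gcongr)
    _ = _ := by ring

end Gradient

section Whitney

variable {d m : ℕ} {P Q : Pt d m}

lemma norm_pos_of_mem_Omega (hP : P ∈ Omega d m) : 0 < ‖P.2‖ := norm_pos_iff.2 hP.1

lemma measurableSet_Omega : MeasurableSet (Omega d m) := by
  have : Omega d m = {P | P.2 ≠ 0} ∩ ⋂ _ : m = 1, ⋂ i, {P | 0 < P.2 i} := by
    ext P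
    simp [Omega, TSet]
  rw [this]
  refine (isOpen_ne_fun continuous_snd continuous_const).measurableSet.inter
    (MeasurableSet.iInter fun _ => MeasurableSet.iInter fun i => ?_)
  exact (isOpen_lt continuous_const (by fun_prop)).measurableSet

lemma mem_Omega_of_norm_sub_lt (hP : P ∈ Omega d m) (h : ‖Q.2 - P.2‖ < ‖P.2‖) :
    Q ∈ Omega d m := by
  refine ⟨fun h0 => by simp [h0] at h, ?_⟩
  rintro rfl i
  have hi : ∀ j : Fin 1, j = i := fun j => Subsingleton.elim _ _
  have hp := hP.2 rfl i
  rw [EuclideanSpace.norm_eq, EuclideanSpace.norm_eq] at h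
  simp only [Finset.univ_unique, Finset.sum_singleton, hi, PiLp.sub_apply, Real.norm_eq_abs,
    Real.sqrt_sq_eq_abs, abs_abs, abs_of_pos hp] at h
  linarith [(abs_lt.1 h).1]

lemma closedBall_subset_Omega (hP : P ∈ Omega d m) :
    closedBall P (‖P.2‖ / 4) ⊆ Omega d m := by
  intro Q hQ
  have := norm_pos_of_mem_Omega hP
  rw [mem_closedBall, dist_eq_norm] at hQ
  exact mem_Omega_of_norm_sub_lt hP
    (((norm_snd_le (Q - P)).trans hQ).trans_lt (by linarith))

lemma whitneyBall_subset_closedBall : whitneyBall P ⊆ closedBall P (‖P.2‖ / 4) := by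
  intro Q hQ
  have hQ : edist2 Q P < ‖P.2‖ / 4 := hQ
  rw [mem_closedBall, dist_eq_norm]
  refine le_trans ?_ hQ.le
  refine max_le (Real.le_sqrt_of_sq_le ?_) (Real.le_sqrt_of_sq_le ?_)
  · simp
  · simp

lemma continuous_edist2 : Continuous fun Z : Pt d m × Pt d m => edist2 Z.1 Z.2 := by
  unfold edist2
  fun_prop

lemma isOpen_whitneyBall : IsOpen (whitneyBall P) :=
  isOpen_lt (f := fun Z => edist2 Z P)
    (continuous_edist2.comp (f := fun Z => (Z, P)) (by fun_prop)) continuous_const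

instance : (volume : Measure (Pt d m)).IsAddHaarMeasure :=
  inferInstanceAs ((volume : Measure (EuclideanSpace ℝ (Fin d))).prod
    (volume : Measure (EuclideanSpace ℝ (Fin m)))).IsAddHaarMeasure

lemma finrank_Pt : Module.finrank ℝ (Pt d m) = d + m := by simp

lemma volume_closedBall_Pt (P : Pt d m) {ρ : ℝ} (hρ : 0 ≤ ρ) :
    volume (closedBall P ρ) = ENNReal.ofReal (ρ ^ (d + m)) * volume (ball (0 : Pt d m) 1) := by
  rw [Measure.addHaar_closedBall _ _ hρ, finrank_Pt]

lemma volume_whitneyBall_le (P : Pt d m) : volume (whitneyBall P) ≤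
    ENNReal.ofReal ((‖P.2‖ / 4) ^ (d + m)) * volume (ball (0 : Pt d m) 1) :=
  (measure_mono whitneyBall_subset_closedBall).trans (volume_closedBall_Pt P (by positivity)).le

lemma lintegral_whitneyBall_le {v : Pt d m → ℝ} (hv : ContinuousOn v (Omega d m))
    (hP : P ∈ Omega d m) :
    ∫⁻ Q in whitneyBall P, ENNReal.ofReal (v Q ^ 2) ≤
      NtildeE d m v P.1 ^ 2 * volume (whitneyBall P) := by
  have ht := norm_pos_of_mem_Omega hP
  have hfin : volume (whitneyBall P) ≠ ⊤ :=
    ((measure_mono whitneyBall_subset_closedBall).trans_lt measure_closedBall_lt_top).ne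
  have hpos : 0 < (volume (whitneyBall P)).toReal := by
    refine ENNReal.toReal_pos (isOpen_whitneyBall.measure_pos _ ⟨P, ?_⟩).ne' hfin
    change edist2 P P < ‖P.2‖ / 4
    simpa [edist2] using ht
  have hint : IntegrableOn (fun Q => v Q ^ 2) (whitneyBall P) :=
    (((hv.mono (closedBall_subset_Omega hP)).pow 2).integrableOn_compact
      (isCompact_closedBall _ _)).mono_set whitneyBall_subset_closedBall
  rw [← ofReal_integral_eq_lintegral_ofReal hint (ae_of_all _ fun Q => sq_nonneg _)]
  have hN : ENNReal.ofReal (whitneyAvg d m v P) ≤ NtildeE d m v P.1 :=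
    le_iSup (fun P' : {P' : Pt d m // P' ∈ Omega d m ∧ ‖P'.1 - P.1‖ < ‖P'.2‖} =>
      ENNReal.ofReal (whitneyAvg d m v P'.val)) ⟨P, hP, by simpa using ht⟩
  have hI : 0 ≤ ∫ Q in whitneyBall P, v Q ^ 2 := integral_nonneg fun Q => sq_nonneg _
  calc _ = ENNReal.ofReal (whitneyAvg d m v P) ^ 2 * volume (whitneyBall P) := by
        rw [whitneyAvg, ← ENNReal.ofReal_pow (Real.sqrt_nonneg _),
          Real.sq_sqrt (div_nonneg hI hpos.le)]
        nth_rw 2 [← ENNReal.ofReal_toReal hfin]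
        rw [← ENNReal.ofReal_mul (div_nonneg hI hpos.le), div_mul_cancel₀ _ hpos.ne']
    _ ≤ _ := by gcongr

lemma mem_whitneyBall_of_mem_closedBall (hQ : 0 < ‖Q.2‖) (h : P ∈ closedBall Q (‖Q.2‖ / 8)) :
    Q ∈ whitneyBall P := by
  rw [mem_closedBall', dist_eq_norm] at h
  have h1 : ‖Q.1 - P.1‖ ≤ ‖Q.2‖ / 8 := (norm_fst_le (Q - P)).trans h
  have h2 : ‖Q.2 - P.2‖ ≤ ‖Q.2‖ / 8 := (norm_snd_le (Q - P)).trans h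
  have h3 := norm_sub_norm_le Q.2 P.2
  change Real.sqrt _ < _
  rw [Real.sqrt_lt' (by linarith)]
  calc _ ≤ (‖Q.2‖ / 8) ^ 2 + (‖Q.2‖ / 8) ^ 2 := by gcongr
    _ < (7 / 8 * ‖Q.2‖ / 4) ^ 2 := by nlinarith
    _ ≤ _ := by gcongr; linarith

end Whitney

section Shell

variable {d m : ℕ} {h : EuclideanSpace ℝ (Fin d) → ℝ} {v : Pt d m → ℝ}

/-- The part in `Ω` of the shell `{h(y)/2 ≤ |t| ≤ 3 h(y)}`, a thickening of `shell d m h`. -/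
def thickShell (d m : ℕ) (h : EuclideanSpace ℝ (Fin d) → ℝ) : Set (Pt d m) :=
  Omega d m ∩ {P | h P.1 / 2 ≤ ‖P.2‖ ∧ ‖P.2‖ ≤ 3 * h P.1}

lemma measurableSet_verticalStrip (hc : Continuous h) (a b : ℝ) :
    MeasurableSet {P : Pt d m | a * h P.1 ≤ ‖P.2‖ ∧ ‖P.2‖ ≤ b * h P.1} := by
  have : Continuous fun P : Pt d m => h P.1 := hc.comp continuous_fst
  have h1 : MeasurableSet {P : Pt d m | a * h P.1 ≤ ‖P.2‖} :=
    (isClosed_le (by fun_prop) (by fun_prop)).measurableSet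
  have h2 : MeasurableSet {P : Pt d m | ‖P.2‖ ≤ b * h P.1} :=
    (isClosed_le (by fun_prop) (by fun_prop)).measurableSet
  exact h1.inter h2

lemma measurableSet_shell (hc : Continuous h) : MeasurableSet (shell d m h) := by
  simpa [shell] using measurableSet_verticalStrip (m := m) hc 1 2

lemma measurableSet_thickShell (hc : Continuous h) : MeasurableSet (thickShell d m h) := by
  simpa [thickShell, div_eq_inv_mul] using
    measurableSet_Omega.inter (measurableSet_verticalStrip (m := m) hc 2⁻¹ 3)

lemma closedBall_subset_thickShell (hL : LipschitzWith (1 / 2) h) {Q : Pt d m}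
    (hQ : Q ∈ Omega d m ∩ shell d m h) :
    closedBall Q (‖Q.2‖ / 8) ⊆ thickShell d m h := by
  intro P hP
  have ht := norm_pos_of_mem_Omega hQ.1
  have hΩ : P ∈ Omega d m :=
    closedBall_subset_Omega hQ.1 (closedBall_subset_closedBall (by linarith) hP)
  rw [mem_closedBall, dist_eq_norm] at hP
  have h1 : ‖P.1 - Q.1‖ ≤ ‖Q.2‖ / 8 := (norm_fst_le (P - Q)).trans hP
  have h2 : ‖P.2 - Q.2‖ ≤ ‖Q.2‖ / 8 := (norm_snd_le (P - Q)).trans hP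
  have h3 := abs_le.1 ((abs_norm_sub_norm_le P.2 Q.2).trans h2)
  have h4 := hL.dist_le_mul P.1 Q.1
  rw [Real.dist_eq, dist_eq_norm] at h4
  have h5 : |h P.1 - h Q.1| ≤ ‖Q.2‖ / 16 := by
    refine h4.trans ?_
    simp only [NNReal.coe_div, NNReal.coe_one, NNReal.coe_ofNat]
    linarith
  have h6 := abs_le.1 h5
  obtain ⟨h7, h8⟩ : h Q.1 ≤ ‖Q.2‖ ∧ ‖Q.2‖ ≤ 2 * h Q.1 := hQ.2
  exact ⟨hΩ, by linarith, by linarith⟩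

lemma lintegral_thickShell_fiber_le (y : EuclideanSpace ℝ (Fin d)) :
    ∫⁻ t, (thickShell d m h).indicator (fun P => ENNReal.ofReal ((‖P.2‖ ^ m)⁻¹)) (y, t) ≤
      ENNReal.ofReal (6 ^ m) * volume (ball (0 : EuclideanSpace ℝ (Fin m)) 1) := by
  rcases le_or_gt (h y) 0 with hy | hy
  · refine le_of_eq_of_le ?_ zero_le
    rw [← lintegral_zero]
    congr 1
    ext t
    refine indicator_of_notMem ?_ _
    rintro ⟨hΩ, -, h'⟩
    have := norm_pos_of_mem_Omega hΩ
    dsimp only at h' this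
    linarith
  · calc _ ≤ ∫⁻ t, (closedBall (0 : EuclideanSpace ℝ (Fin m)) (3 * h y)).indicator
          (fun _ => ENNReal.ofReal (((h y / 2) ^ m)⁻¹)) t := by
          refine lintegral_mono fun t => ?_
          by_cases ht : (y, t) ∈ thickShell d m h
          · have h2 : h y / 2 ≤ ‖t‖ := ht.2.1
            have h3 : ‖t‖ ≤ 3 * h y := ht.2.2
            rw [indicator_of_mem ht, indicator_of_mem (by simpa using h3)]
            dsimp only
            gcongr
          · rw [indicator_of_notMem ht]
            exact zero_le
      _ = _ := by
          rw [lintegral_indicator_const measurableSet_closedBall,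
            Measure.addHaar_closedBall _ _ (by positivity), ← mul_assoc,
            ← ENNReal.ofReal_mul (by positivity), finrank_euclideanSpace_fin, ← inv_pow, ← mul_pow]
          congr 3
          field_simp
          norm_num

/-- The constant of the shell estimate. -/
def shellConst (d m : ℕ) : ℝ≥0∞ :=
  (volume (ball (0 : Pt d m) 1))⁻¹ * ENNReal.ofReal (8 ^ (d + m) * 2 ^ (d + m + m)) *
    volume (ball (0 : Pt d m) 1) *
    (ENNReal.ofReal (6 ^ m) * volume (ball (0 : EuclideanSpace ℝ (Fin m)) 1))

lemma volume_ball_Pt_ne_zero : volume (ball (0 : Pt d m) 1) ≠ 0 :=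
  (measure_ball_pos _ _ one_pos).ne'

lemma shellConst_ne_top : shellConst d m ≠ ⊤ := by
  unfold shellConst
  exact ENNReal.mul_ne_top (ENNReal.mul_ne_top (ENNReal.mul_ne_top
    (ENNReal.inv_ne_top.2 volume_ball_Pt_ne_zero) ENNReal.ofReal_ne_top) measure_ball_lt_top.ne)
    (ENNReal.mul_ne_top ENNReal.ofReal_ne_top measure_ball_lt_top.ne)

/-- The averaging kernel of `Q` against the Whitney balls with centre `P` in the thickened
shell. -/
def whitneyKernel (h : EuclideanSpace ℝ (Fin d) → ℝ) (v : Pt d m → ℝ) (Q P : Pt d m) : ℝ≥0∞ :=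
  (thickShell d m h).indicator
    (fun P => (volume (ball (0 : Pt d m) 1))⁻¹ *
      ENNReal.ofReal (8 ^ (d + m) * 2 ^ (d + m + m) * (‖P.2‖ ^ (d + m + m))⁻¹)) P *
    (whitneyBall P).indicator ((Omega d m).indicator fun Q => ENNReal.ofReal (v Q ^ 2)) Q

lemma measurable_indicator_Omega (hv : ContinuousOn v (Omega d m)) :
    Measurable ((Omega d m).indicator fun Q => ENNReal.ofReal (v Q ^ 2)) := by
  classical
  rw [← piecewise_eq_indicator]
  exact (ENNReal.continuous_ofReal.comp_continuousOn (hv.pow 2)).measurable_piecewise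
    continuousOn_const measurableSet_Omega

lemma measurable_whitneyKernel (hc : Continuous h) (hv : ContinuousOn v (Omega d m)) :
    Measurable (Function.uncurry (whitneyKernel h v)) := by
  refine Measurable.mul ?_ ?_
  · refine (Measurable.indicator ?_ (measurableSet_thickShell hc)).comp measurable_snd
    fun_prop
  · have hs : MeasurableSet {Z : Pt d m × Pt d m | edist2 Z.1 Z.2 < ‖Z.2.2‖ / 4} :=
      (isOpen_lt continuous_edist2 (by fun_prop)).measurableSet
    exact ((measurable_indicator_Omega hv).comp measurable_fst).indicator hs

lemma le_lintegral_whitneyKernel (hL : LipschitzWith (1 / 2) h) {Q : Pt d m}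
    (hQ : Q ∈ Omega d m ∩ shell d m h) :
    ENNReal.ofReal (v Q ^ 2) * ENNReal.ofReal ((‖Q.2‖ ^ m)⁻¹) ≤ ∫⁻ P, whitneyKernel h v Q P := by
  have ht := norm_pos_of_mem_Omega hQ.1
  set κ := volume (ball (0 : Pt d m) 1) with hκ
  have hκ0 : κ ≠ 0 := volume_ball_Pt_ne_zero
  have hκt : κ ≠ ⊤ := measure_ball_lt_top.ne
  set c := κ⁻¹ * ENNReal.ofReal (8 ^ (d + m) * (‖Q.2‖ ^ (d + m + m))⁻¹) *
    ENNReal.ofReal (v Q ^ 2) with hcdef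
  calc _ = c * volume (closedBall Q (‖Q.2‖ / 8)) := by
        rw [volume_closedBall_Pt _ (by positivity), ← hκ]
        have : c * (ENNReal.ofReal ((‖Q.2‖ / 8) ^ (d + m)) * κ) = (κ⁻¹ * κ) *
            (ENNReal.ofReal (v Q ^ 2) * (ENNReal.ofReal (8 ^ (d + m) * (‖Q.2‖ ^ (d + m + m))⁻¹) *
              ENNReal.ofReal ((‖Q.2‖ / 8) ^ (d + m)))) := by
          rw [hcdef]; ring
        rw [this, ENNReal.inv_mul_cancel hκ0 hκt, one_mul,
          ← ENNReal.ofReal_mul (p := 8 ^ (d + m) * _) (by positivity)]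
        congr 2
        rw [div_pow, pow_add _ (d + m) m]
        field_simp
    _ = ∫⁻ P, (closedBall Q (‖Q.2‖ / 8)).indicator (fun _ => c) P :=
        (lintegral_indicator_const measurableSet_closedBall _).symm
    _ ≤ _ := by
        refine lintegral_mono fun P => ?_
        by_cases hP : P ∈ closedBall Q (‖Q.2‖ / 8)
        · have hPs := closedBall_subset_thickShell hL hQ hP
          have hPt := norm_pos_of_mem_Omega hPs.1
          rw [whitneyKernel, indicator_of_mem hP, indicator_of_mem hPs,
            indicator_of_mem (mem_whitneyBall_of_mem_closedBall ht hP), indicator_of_mem hQ.1]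
          dsimp only
          rw [hcdef]
          rw [mem_closedBall, dist_eq_norm] at hP
          have h3 := norm_sub_norm_le P.2 Q.2
          have h2 : ‖P.2 - Q.2‖ ≤ ‖Q.2‖ / 8 := (norm_snd_le (P - Q)).trans hP
          refine mul_le_mul_left (mul_le_mul_right (ENNReal.ofReal_le_ofReal ?_) _) _
          rw [mul_assoc]
          gcongr
          rw [← div_eq_mul_inv, le_div_iff₀ (by positivity), inv_mul_le_iff₀ (by positivity),
            ← mul_pow]
          gcongr
          linarith
        · rw [indicator_of_notMem hP]
          exact zero_le

lemma lintegral_whitneyKernel_le (hv : ContinuousOn v (Omega d m)) (P : Pt d m) :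
    ∫⁻ Q, whitneyKernel h v Q P ≤
      (volume (ball (0 : Pt d m) 1))⁻¹ * ENNReal.ofReal (8 ^ (d + m) * 2 ^ (d + m + m)) *
        volume (ball (0 : Pt d m) 1) * (NtildeE d m v P.1 ^ 2 *
          (thickShell d m h).indicator (fun P => ENNReal.ofReal ((‖P.2‖ ^ m)⁻¹)) P) := by
  unfold whitneyKernel
  by_cases hP : P ∈ thickShell d m h
  · have ht := norm_pos_of_mem_Omega hP.1
    rw [lintegral_const_mul _ ((measurable_indicator_Omega hv).indicator
      isOpen_whitneyBall.measurableSet), lintegral_indicator isOpen_whitneyBall.measurableSet,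
      indicator_of_mem hP, indicator_of_mem hP]
    have h1 : ∫⁻ Q in whitneyBall P, (Omega d m).indicator (fun Q => ENNReal.ofReal (v Q ^ 2)) Q ≤
        NtildeE d m v P.1 ^ 2 *
          (ENNReal.ofReal (‖P.2‖ ^ (d + m)) * volume (ball (0 : Pt d m) 1)) := by
      refine (lintegral_mono fun Q => indicator_le_self _ _ _).trans
        ((lintegral_whitneyBall_le hv hP.1).trans ?_)
      gcongr
      refine (volume_whitneyBall_le P).trans ?_
      gcongr
      linarith
    refine (mul_le_mul_right h1 _).trans (le_of_eq ?_)
    have e : ENNReal.ofReal (8 ^ (d + m) * 2 ^ (d + m + m) * (‖P.2‖ ^ (d + m + m))⁻¹) *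
        ENNReal.ofReal (‖P.2‖ ^ (d + m)) =
        ENNReal.ofReal (8 ^ (d + m) * 2 ^ (d + m + m)) * ENNReal.ofReal ((‖P.2‖ ^ m)⁻¹) := by
      rw [← ENNReal.ofReal_mul (by positivity), ← ENNReal.ofReal_mul (by positivity)]
      congr 1
      rw [pow_add ‖P.2‖ (d + m) m]
      field_simp
    generalize volume (ball (0 : Pt d m) 1) = κ
    generalize NtildeE d m v P.1 ^ 2 = N
    calc _ = κ⁻¹ * κ * N * (ENNReal.ofReal (8 ^ (d + m) * 2 ^ (d + m + m) *
          (‖P.2‖ ^ (d + m + m))⁻¹) * ENNReal.ofReal (‖P.2‖ ^ (d + m))) := by ring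
      _ = _ := by rw [e]; ring
  · simp [indicator_of_notMem hP]

theorem setLIntegral_shell_le (hL : LipschitzWith (1 / 2) h) (hv : ContinuousOn v (Omega d m)) :
    ∫⁻ P in Omega d m ∩ shell d m h,
      ENNReal.ofReal (v P ^ 2) * ENNReal.ofReal ((‖P.2‖ ^ m)⁻¹) ≤
      shellConst d m * ∫⁻ x, NtildeE d m v x ^ 2 := by
  have hc := hL.continuous
  have hs : MeasurableSet (Omega d m ∩ shell d m h) :=
    measurableSet_Omega.inter (measurableSet_shell hc)
  set K := (volume (ball (0 : Pt d m) 1))⁻¹ * ENNReal.ofReal (8 ^ (d + m) * 2 ^ (d + m + m)) *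
        volume (ball (0 : Pt d m) 1) with hK
  have hKt : K ≠ ⊤ := ENNReal.mul_ne_top (ENNReal.mul_ne_top
    (ENNReal.inv_ne_top.2 volume_ball_Pt_ne_zero) ENNReal.ofReal_ne_top) measure_ball_lt_top.ne
  set c := ENNReal.ofReal (6 ^ m) * volume (ball (0 : EuclideanSpace ℝ (Fin m)) 1) with hcdef
  have hct : c ≠ ⊤ := ENNReal.mul_ne_top ENNReal.ofReal_ne_top measure_ball_lt_top.ne
  have hw : Measurable ((thickShell d m h).indicator
      (fun P => ENNReal.ofReal ((‖P.2‖ ^ m)⁻¹))) :=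
    Measurable.indicator (by fun_prop) (measurableSet_thickShell hc)
  calc _ ≤ ∫⁻ Q in Omega d m ∩ shell d m h, ∫⁻ P, whitneyKernel h v Q P :=
        setLIntegral_mono' hs fun Q hQ => le_lintegral_whitneyKernel hL hQ
    _ ≤ ∫⁻ Q, ∫⁻ P, whitneyKernel h v Q P := setLIntegral_le_lintegral _ _
    _ = ∫⁻ P, ∫⁻ Q, whitneyKernel h v Q P :=
        lintegral_lintegral_swap (measurable_whitneyKernel hc hv).aemeasurable
    _ ≤ ∫⁻ P : Pt d m, K * (NtildeE d m v P.1 ^ 2 *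
          (thickShell d m h).indicator (fun P => ENNReal.ofReal ((‖P.2‖ ^ m)⁻¹)) P) :=
        lintegral_mono fun P => lintegral_whitneyKernel_le hv P
    _ = K * ∫⁻ P : Pt d m, NtildeE d m v P.1 ^ 2 *
          (thickShell d m h).indicator (fun P => ENNReal.ofReal ((‖P.2‖ ^ m)⁻¹)) P :=
        lintegral_const_mul' _ _ hKt
    _ ≤ K * ∫⁻ y, ∫⁻ t, NtildeE d m v y ^ 2 *
          (thickShell d m h).indicator (fun P => ENNReal.ofReal ((‖P.2‖ ^ m)⁻¹)) (y, t) := by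
        gcongr
        exact lintegral_prod_le _
    _ ≤ K * ∫⁻ y, NtildeE d m v y ^ 2 * c := by
        gcongr with y
        refine (lintegral_const_mul _ (hw.comp measurable_prodMk_left)).trans_le ?_
        gcongr
        exact lintegral_thickShell_fiber_le y
    _ = _ := by
        rw [lintegral_mul_const' _ _ hct, shellConst, ← hK, ← hcdef]
        ring

end Shell

lemma lipschitzWith_half_infDist {d : ℕ} (s : Set (EuclideanSpace ℝ (Fin d))) :
    LipschitzWith (1 / 2) fun y => infDist y s / 2 := by
  refine LipschitzWith.of_dist_le_mul fun x y => ?_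
  have := (lipschitz_infDist_pt s).dist_le_mul x y
  rw [Real.dist_eq] at this ⊢
  rw [← sub_div, abs_div, abs_of_pos (two_pos : (0 : ℝ) < 2)]
  simp only [NNReal.coe_div, NNReal.coe_one, NNReal.coe_ofNat, one_mul] at this ⊢
  linarith

lemma ofReal_gradient_le {d m : ℕ} {φ : ℝ → ℝ} (hφ : cutoffProps φ)
    (xB : EuclideanSpace ℝ (Fin d)) {r ε : ℝ} (hr : 0 < r) (hε : 0 < ε) {P : Pt d m}
    (hP : P.2 ≠ 0) (a : ℝ) :
    ENNReal.ofReal ((‖P.2‖ * ‖fderiv ℝ (PsiBe d m φ xB r ε) P‖ +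
        ‖P.2‖ ^ 2 * ‖fderiv ℝ (PsiBe d m φ xB r ε) P‖ ^ 2) * a ^ 2 / ‖P.2‖ ^ m) ≤
      ENNReal.ofReal 600 * (ENNReal.ofReal (a ^ 2) * ENNReal.ofReal ((‖P.2‖ ^ m)⁻¹)) := by
  have ht : 0 < ‖P.2‖ := norm_pos_iff.2 hP
  have h := norm_fderiv_PsiBe_le xB hφ hr hε hP
  rw [le_div_iff₀' ht] at h
  rw [← ENNReal.ofReal_mul (by positivity), ← ENNReal.ofReal_mul (by positivity), ← mul_pow,
    mul_div_assoc, div_eq_mul_inv]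
  gcongr
  nlinarith [mul_nonneg ht.le (norm_nonneg (fderiv ℝ (PsiBe d m φ xB r ε) P))]

/-- the Carleson estimate (4.12) in Step 1 of the proof of
Lemma 4.1 of the paper: for every continuous `v` on `Ω`,
`∫_Ω (|t||∇Ψ_{B,ε}| + |t|²|∇Ψ_{B,ε}|²) v² dtdy/|t|^{n-d} ≲ ‖Ñ(v)‖₂²`. -/
theorem statement7 (d n : ℕ) (hd : 1 ≤ d) (hdn : d < n) :
    ∃ C : ℝ, 0 < C ∧
    ∀ φ : ℝ → ℝ, cutoffProps φ →
    ∀ (xB : EuclideanSpace ℝ (Fin d)) (r : ℝ), 0 < r → ∀ ε : ℝ, 0 < ε →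
    ∀ v : Pt d (n - d) → ℝ, ContinuousOn v (Omega d (n - d)) →
      (∫⁻ P in Omega d (n - d), ENNReal.ofReal
          ((‖P.2‖ * ‖fderiv ℝ (PsiBe d (n - d) φ xB r ε) P‖ +
            ‖P.2‖ ^ 2 * ‖fderiv ℝ (PsiBe d (n - d) φ xB r ε) P‖ ^ 2) *
            (v P) ^ 2 / ‖P.2‖ ^ (n - d)))
        ≤ ENNReal.ofReal C * ∫⁻ x, (NtildeE d (n - d) v x) ^ 2 := by

  refine ⟨(ENNReal.ofReal 600 * (3 * shellConst d (n - d))).toReal + 1, by positivity, ?_⟩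
  intro φ hφ xB r hr ε hε v hv
  generalize n - d = m at v hv ⊢
  set A := shell d m fun y => infDist y (ball xB r) / 2
  set B := shell d m fun _ => r
  set D := shell d m fun _ => ε / 2
  have hfin : ENNReal.ofReal 600 * (3 * shellConst d m) ≠ ⊤ :=
    ENNReal.mul_ne_top ENNReal.ofReal_ne_top (ENNReal.mul_ne_top (by simp) shellConst_ne_top)
  set w : Pt d m → ℝ≥0∞ := fun P => ENNReal.ofReal (v P ^ 2) * ENNReal.ofReal ((‖P.2‖ ^ m)⁻¹)
  have hm := measurableSet_Omega (d := d) (m := m)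
  have hLr : ∀ a : ℝ, LipschitzWith (1 / 2) fun _ : EuclideanSpace ℝ (Fin d) => a := fun a =>
    (LipschitzWith.const a).weaken zero_le
  calc _ ≤ ∫⁻ P in Omega d m, ((Omega d m ∩ A) ∪ (Omega d m ∩ B) ∪ (Omega d m ∩ D)).indicator
          (fun P => ENNReal.ofReal 600 * w P) P := by
        refine setLIntegral_mono' hm fun P hP => ?_
        by_cases hmem : P ∈ (Omega d m ∩ A) ∪ (Omega d m ∩ B) ∪ (Omega d m ∩ D)
        · rw [indicator_of_mem hmem]
          exact ofReal_gradient_le hφ xB hr hε hP.1 _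
        · simp only [mem_union, mem_inter_iff, hP, true_and, not_or] at hmem
          rw [fderiv_PsiBe_eq_zero xB hφ hr hε hP.1 hmem.1.1 hmem.1.2 hmem.2]
          simp
    _ ≤ ∫⁻ P, ((Omega d m ∩ A) ∪ (Omega d m ∩ B) ∪ (Omega d m ∩ D)).indicator
          (fun P => ENNReal.ofReal 600 * w P) P := setLIntegral_le_lintegral _ _
    _ ≤ ∫⁻ P in (Omega d m ∩ A) ∪ (Omega d m ∩ B) ∪ (Omega d m ∩ D),
          ENNReal.ofReal 600 * w P := lintegral_indicator_le _ _
    _ = ENNReal.ofReal 600 * ∫⁻ P in (Omega d m ∩ A) ∪ (Omega d m ∩ B) ∪ (Omega d m ∩ D), w P :=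
        lintegral_const_mul' _ _ ENNReal.ofReal_ne_top
    _ ≤ ENNReal.ofReal 600 * ((∫⁻ P in Omega d m ∩ A, w P) + (∫⁻ P in Omega d m ∩ B, w P) +
          ∫⁻ P in Omega d m ∩ D, w P) := by
        gcongr
        refine (lintegral_union_le _ _ _).trans ?_
        gcongr
        exact lintegral_union_le _ _ _
    _ ≤ ENNReal.ofReal 600 * (shellConst d m * (∫⁻ x, NtildeE d m v x ^ 2) +
          shellConst d m * (∫⁻ x, NtildeE d m v x ^ 2) +
          shellConst d m * ∫⁻ x, NtildeE d m v x ^ 2) := by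
        gcongr
        · exact setLIntegral_shell_le (lipschitzWith_half_infDist _) hv
        · exact setLIntegral_shell_le (hLr _) hv
        · exact setLIntegral_shell_le (hLr _) hv
    _ = ENNReal.ofReal 600 * (3 * shellConst d m) * ∫⁻ x, NtildeE d m v x ^ 2 := by ring
    _ ≤ _ := by
        gcongr
        refine (ENNReal.le_ofReal_iff_toReal_le hfin (by positivity)).2 ?_
        linarith
end
end
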